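/- For n ≥ 5, f(n; κ̄_n = 1) = C(n−1, 2) + 1; that is, the maximum number of edges of a connected graph G on n vertices with κ̄_n(G) = 1 equals C(n−1, 2) + 1, and in particular this maximum is attained by some such graph. -/

import Mathlib

open SimpleGraph

/-- An `S`-Steiner tree in `G`: a subgraph that is a tree and contains `S`. -/
def SimpleGraph.IsSteinerTree {V : Type*} (G : SimpleGraph V) (S : Set V)
    (T : G.Subgraph) : Prop :=
  S ⊆ T.verts ∧ T.coe.IsTree

/-- `κ(S)`: the maximum number of pairwise internally disjoint `S`-Steiner trees in `G`. -/
noncomputable def SimpleGraph.steinerConn {V : Type*} (G : SimpleGraph V) (S : Set V) : ℕ :=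
  sSup {n : ℕ | ∃ f : Fin n → G.Subgraph,
    (∀ i, G.IsSteinerTree S (f i)) ∧
    ∀ i j, i ≠ j →
      (f i).edgeSet ∩ (f j).edgeSet = ∅ ∧ (f i).verts ∩ (f j).verts = S}

/-- `κ̄ₖ(G) = max {κ(S) : S ⊆ V(G), |S| = k}`, the maximal generalized local connectivity. -/
noncomputable def SimpleGraph.kappaBar {V : Type*} (G : SimpleGraph V) (k : ℕ) : ℕ :=
  sSup {m : ℕ | ∃ S : Finset V, S.card = k ∧ G.steinerConn ↑S = m}

/-- `p` is an ear of the cycle `c` in `G`: a nontrivial path (whose two endpoints may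
coincide) meeting `c` exactly in its endpoints. -/
def SimpleGraph.IsEar {V : Type*} (G : SimpleGraph V) {x u v : V}
    (c : G.Walk x x) (p : G.Walk u v) : Prop :=
  0 < p.length ∧ u ∈ c.support ∧ v ∈ c.support ∧
  p.support.tail.Nodup ∧ (u = v ∨ u ∉ p.support.tail) ∧
  ∀ w ∈ p.support, w ∈ c.support → w = u ∨ w = v

namespace SimpleGraph

variable {V : Type*}

/-- `G` contains two edge-disjoint connected spanning subgraphs. -/
def HasDisjointConnectedPair (G : SimpleGraph V) : Prop :=
  ∃ H₁ H₂ : SimpleGraph V, H₁ ≤ G ∧ H₂ ≤ G ∧ Disjoint H₁ H₂ ∧ H₁.Connected ∧ H₂.Connected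

section Steiner

variable {G : SimpleGraph V}

lemma IsSteinerTree.exists_adj [Nontrivial V] {T : G.Subgraph}
    (hT : G.IsSteinerTree Set.univ T) (v : V) : ∃ w, T.Adj v w := by
  obtain ⟨u, hu⟩ := exists_ne v
  have : Nontrivial T.verts :=
    ⟨⟨v, hT.1 trivial⟩, ⟨u, hT.1 trivial⟩, fun h ↦ hu (congrArg Subtype.val h).symm⟩
  obtain ⟨w, hw⟩ := hT.2.connected.preconnected.exists_adj_of_nontrivial ⟨v, hT.1 trivial⟩
  exact ⟨w, hw⟩

lemma bddAbove_steinerConn_univ [Finite V] [Nontrivial V] (G : SimpleGraph V) :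
    BddAbove {n : ℕ | ∃ f : Fin n → G.Subgraph, (∀ i, G.IsSteinerTree Set.univ (f i)) ∧
      ∀ i j, i ≠ j → (f i).edgeSet ∩ (f j).edgeSet = ∅ ∧
        (f i).verts ∩ (f j).verts = Set.univ} := by
  refine ⟨Nat.card (Sym2 V), ?_⟩
  rintro m ⟨f, hf, hd⟩
  obtain ⟨v, -⟩ := exists_pair_ne V
  choose w hw using fun i ↦ (hf i).exists_adj v
  have hinj : Function.Injective fun i ↦ s(v, w i) := by
    intro i j hij
    by_contra hne
    have hmem : s(v, w i) ∈ (f i).edgeSet ∩ (f j).edgeSet :=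
      ⟨hw i, by rw [show s(v, w i) = s(v, w j) from hij]; exact hw j⟩
    simp [(hd i j hne).1] at hmem
  simpa using Nat.card_le_card_of_injective _ hinj

lemma le_steinerConn_univ [Finite V] [Nontrivial V] {m : ℕ} (H : Fin m → SimpleGraph V)
    (hle : ∀ i, H i ≤ G) (hconn : ∀ i, (H i).Connected)
    (hdisj : ∀ i j, i ≠ j → Disjoint (H i) (H j)) : m ≤ G.steinerConn Set.univ := by
  choose T hTle hT using fun i ↦ (hconn i).exists_isTree_le
  refine le_csSup G.bddAbove_steinerConn_univ
    ⟨fun i ↦ toSubgraph (T i) ((hTle i).trans (hle i)), fun i ↦ ⟨fun _ _ ↦ trivial, ?_⟩,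
      fun i j hij ↦ ⟨?_, by simp⟩⟩
  · exact (Subgraph.spanningCoeEquivCoeOfSpanning _
      (toSubgraph.isSpanning _ _)).isTree_iff.1 (hT i)
  · have h := disjoint_edgeSet.2 ((hdisj i j hij).mono (hTle i) (hTle j))
    exact Set.disjoint_iff_inter_eq_empty.1 h

lemma HasDisjointConnectedPair.two_le_steinerConn [Finite V] [Nontrivial V]
    (h : G.HasDisjointConnectedPair) : 2 ≤ G.steinerConn Set.univ := by
  obtain ⟨H₁, H₂, hle₁, hle₂, hdisj, hconn₁, hconn₂⟩ := h
  refine le_steinerConn_univ ![H₁, H₂] ?_ ?_ ?_ <;>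
    simp [Fin.forall_fin_two, hle₁, hle₂, hconn₁, hconn₂, hdisj, hdisj.symm]

lemma steinerConn_univ_le_one_of_pendant [Nontrivial V] {v w : V}
    (h : ∀ x, G.Adj v x → x = w) : G.steinerConn Set.univ ≤ 1 := by
  refine csSup_le' ?_
  rintro m ⟨f, hf, hd⟩
  by_contra! hm
  have hadj (i) : (f i).Adj v w := by
    obtain ⟨x, hx⟩ := (hf i).exists_adj v
    exact h x hx.adj_sub ▸ hx
  have hmem : s(v, w) ∈ (f ⟨0, by omega⟩).edgeSet ∩ (f ⟨1, hm⟩).edgeSet := ⟨hadj _, hadj _⟩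
  simp [(hd ⟨0, by omega⟩ ⟨1, hm⟩ (by simp)).1] at hmem

lemma kappaBar_card [Fintype V] (G : SimpleGraph V) :
    G.kappaBar (Fintype.card V) = G.steinerConn Set.univ := by
  simp [kappaBar, Finset.card_eq_iff_eq_univ]

end Steiner

lemma connected_fromEdgeSet_path {m : ℕ} {x : Fin (m + 1) → V} (hx : Function.Bijective x) :
    (fromEdgeSet (Set.range fun t : Fin m ↦ s(x t.castSucc, x t.succ))).Connected := by
  refine (pathGraph_connected m).map ⟨x, ?_⟩ hx.2
  intro a b hab
  rw [fromEdgeSet_adj]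
  refine ⟨?_, hx.1.ne hab.ne⟩
  rcases pathGraph_adj.1 hab with h | h
  · exact ⟨⟨a, by omega⟩, congrArg₂ (fun i j ↦ s(x i, x j)) rfl (Fin.ext h)⟩
  · exact ⟨⟨b, by omega⟩, (congrArg₂ (fun i j ↦ s(x i, x j)) rfl (Fin.ext h)).trans Sym2.eq_swap⟩

/-- The six decompositions of the complete graph on five vertices into two Hamiltonian cycles. -/
def pentagonPair : Fin 6 → (Fin 5 → Fin 5) × (Fin 5 → Fin 5) :=
  ![(![0, 1, 2, 3, 4], ![0, 2, 4, 1, 3]), (![0, 1, 2, 4, 3], ![0, 2, 3, 1, 4]),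
    (![0, 1, 3, 2, 4], ![0, 2, 1, 4, 3]), (![0, 1, 3, 4, 2], ![0, 3, 2, 1, 4]),
    (![0, 1, 4, 2, 3], ![0, 2, 1, 3, 4]), (![0, 1, 4, 3, 2], ![0, 3, 1, 2, 4])]

lemma pentagonPair_bijective (i : Fin 6) :
    Function.Bijective (pentagonPair i).1 ∧ Function.Bijective (pentagonPair i).2 := by
  revert i; decide +kernel

lemma pentagonPair_edge_ne (i : Fin 6) (s t : Fin 5) :
    s((pentagonPair i).1 s, (pentagonPair i).1 (s + 1)) ≠
      s((pentagonPair i).2 t, (pentagonPair i).2 (t + 1)) := by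
  revert i s t; decide +kernel

/-- The path obtained from the closed pentagon `p` by cutting it open just before its `j`-th vertex
uses neither of the edges `e` and `f`. -/
abbrev PentagonCutAvoids (p : Fin 5 → Fin 5) (e f : Sym2 (Fin 5)) (j : Fin 5) : Prop :=
  ∀ t : Fin 4, s(p (j + t.castSucc), p (j + t.castSucc + 1)) ≠ e ∧
    s(p (j + t.castSucc), p (j + t.castSucc + 1)) ≠ f

/-- Any two edges can be avoided by rotating and cutting open a pair of pentagons. -/
lemma exists_pentagonPair_avoiding (a b c d : Fin 5) : ∃ i : Fin 6,
    (∃ j, PentagonCutAvoids (pentagonPair i).1 s(a, b) s(c, d) j) ∧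
      ∃ k, PentagonCutAvoids (pentagonPair i).2 s(a, b) s(c, d) k := by
  have hsorted : ∀ a b c d : Fin 5, a ≤ b → c ≤ d → ∃ i : Fin 6,
      (∃ j, PentagonCutAvoids (pentagonPair i).1 s(a, b) s(c, d) j) ∧
        ∃ k, PentagonCutAvoids (pentagonPair i).2 s(a, b) s(c, d) k := by
    decide +kernel
  rcases le_total a b with hab | hab <;> rcases le_total c d with hcd | hcd
  · exact hsorted a b c d hab hcd
  · rw [Sym2.eq_swap (a := c)]
    exact hsorted a b d c hab hcd
  · rw [Sym2.eq_swap (a := a)]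
    exact hsorted b a c d hab hcd
  · rw [Sym2.eq_swap (a := a), Sym2.eq_swap (a := c)]
    exact hsorted b a d c hab hcd

lemma hasDisjointConnectedPair_of_card_eq_five [Finite V] {G : SimpleGraph V}
    (hV : Nat.card V = 5) (hG : Gᶜ.edgeSet.ncard ≤ 2) : G.HasDisjointConnectedPair := by
  classical
  have := Fintype.ofFinite V
  obtain ⟨φ⟩ : Nonempty (Fin 5 ≃ V) := ⟨(Finite.equivFinOfCardEq hV).symm⟩
  obtain ⟨a, b, c, d, hadj⟩ : ∃ a b c d : Fin 5, ∀ x y, x ≠ y → s(x, y) ≠ s(a, b) →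
      s(x, y) ≠ s(c, d) → G.Adj (φ x) (φ y) := by
    rw [Set.ncard_eq_toFinset_card'] at hG
    obtain ⟨E, hE, hcard⟩ := Finset.exists_superset_card_eq hG (by
      rw [Sym2.card, ← Nat.card_eq_fintype_card, hV]; decide)
    obtain ⟨e, f, -, rfl⟩ := Finset.card_eq_two.1 hcard
    induction e with | _ a b
    induction f with | _ c d
    refine ⟨φ.symm a, φ.symm b, φ.symm c, φ.symm d, fun x y hxy h₁ h₂ ↦ ?_⟩
    by_contra hnot
    have hmem : s(φ x, φ y) ∈ Gᶜ.edgeSet.toFinset := by simp [hxy, hnot]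
    have := hE hmem
    simp only [Finset.mem_insert, Finset.mem_singleton] at this
    rcases this with h | h
    · exact h₁ (by simpa using congrArg (Sym2.map φ.symm) h)
    · exact h₂ (by simpa using congrArg (Sym2.map φ.symm) h)
  obtain ⟨i, ⟨j, hj⟩, k, hk⟩ := exists_pentagonPair_avoiding a b c d
  have hsucc (j : Fin 5) (t : Fin 4) : j + t.succ = j + t.castSucc + 1 := by
    revert j t; decide
  have hbij := pentagonPair_bijective i
  have hconn {p : Fin 5 → Fin 5} (hp : p.Bijective) (j : Fin 5) :=
    connected_fromEdgeSet_path ((φ.bijective.comp hp).comp (Equiv.addLeft j).bijective)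
  have hle {p : Fin 5 → Fin 5} (j : Fin 5)
      (hp : PentagonCutAvoids p s(a, b) s(c, d) j) :
      fromEdgeSet (Set.range fun t : Fin 4 ↦ s(((φ ∘ p) ∘ Equiv.addLeft j) t.castSucc,
        ((φ ∘ p) ∘ Equiv.addLeft j) t.succ)) ≤ G := by
    intro x y hxy
    rw [fromEdgeSet_adj] at hxy
    obtain ⟨⟨t, ht⟩, hne⟩ := hxy
    simp only [Function.comp_apply, Equiv.coe_addLeft, hsucc] at ht
    rw [← mem_edgeSet, ← ht, mem_edgeSet]
    refine hadj _ _ (fun heq ↦ hne ?_) (hp t).1 (hp t).2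
    rw [heq, Sym2.eq_iff] at ht
    rcases ht with ht | ht <;> simp [← ht.1, ← ht.2]
  refine ⟨_, _, hle j hj, hle k hk, ?_, hconn hbij.1 j, hconn hbij.2 k⟩
  rw [disjoint_left]
  intro x y hx hy
  rw [fromEdgeSet_adj] at hx hy
  obtain ⟨⟨s, hs⟩, -⟩ := hx
  obtain ⟨⟨t, ht⟩, -⟩ := hy
  simp only [Function.comp_apply, Equiv.coe_addLeft, hsucc] at hs ht
  refine pentagonPair_edge_ne i (j + s.castSucc) (k + t.castSucc) ?_
  simpa using congrArg (Sym2.map φ.symm) (hs.trans ht.symm)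

lemma ncard_edgeSet_induce_compl_singleton [Finite V] (G : SimpleGraph V) (v : V) :
    (G.induce {v}ᶜ).edgeSet.ncard + (G.neighborSet v).ncard = G.edgeSet.ncard := by
  classical
  have := Fintype.ofFinite V
  have h₁ := G.card_edgeFinset_induce_compl_singleton v
  rw [card_edgeFinset_deleteIncidenceSet] at h₁
  have h₂ := G.degree_le_card_edgeFinset v
  simp only [Set.ncard_eq_toFinset_card', Set.toFinset_card, edgeFinset_card,
    card_neighborSet_eq_degree] at *
  omega

lemma ncard_neighborSet_add_ncard_neighborSet_compl [Finite V] (G : SimpleGraph V) (v : V) :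
    (G.neighborSet v).ncard + (Gᶜ.neighborSet v).ncard + 1 = Nat.card V := by
  rw [← Set.ncard_union_eq (compl_neighborSet_disjoint G v),
    ← Set.ncard_add_ncard_compl {v}, Set.ncard_singleton, add_comm]
  congr 2
  ext w
  have := fun h : G.Adj v w ↦ h.ne'
  simp only [Set.mem_union, mem_neighborSet, compl_adj, Set.mem_compl_iff, Set.mem_singleton_iff]
  grind

lemma Connected.spanningCoe_sup_edge {v w : V} {H : SimpleGraph ({v}ᶜ : Set V)}
    (hH : H.Connected) (hw : w ≠ v) : (H.spanningCoe ⊔ edge v w).Connected := by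
  rw [connected_iff_exists_forall_reachable]
  refine ⟨w, fun x ↦ ?_⟩
  by_cases hx : x = v
  · subst hx
    exact Adj.reachable (Or.inr (by simp [edge_adj, hw]))
  · have h := (hH ⟨w, hw⟩ ⟨x, hx⟩).map (Embedding.map (.subtype _) H).toHom
    exact h.mono le_sup_left

lemma HasDisjointConnectedPair.of_induce_compl_singleton {G : SimpleGraph V} {v : V}
    (h : (G.induce {v}ᶜ).HasDisjointConnectedPair) (hv : (G.neighborSet v).Nontrivial) :
    G.HasDisjointConnectedPair := by
  obtain ⟨H₁, H₂, hle₁, hle₂, hdisj, hconn₁, hconn₂⟩ := h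
  obtain ⟨a, ha, b, hb, hab⟩ := hv
  rw [mem_neighborSet] at ha hb
  have hle {H : SimpleGraph ({v}ᶜ : Set V)} (hH : H ≤ G.induce {v}ᶜ) {w : V} (hw : G.Adj v w) :
      H.spanningCoe ⊔ edge v w ≤ G :=
    sup_le (map_le_iff_le_comap _ _ _ |>.2 hH) ((edge_le_iff G).2 (Or.inr hw))
  refine ⟨_, _, hle hle₁ ha, hle hle₂ hb, ?_, hconn₁.spanningCoe_sup_edge ha.ne',
    hconn₂.spanningCoe_sup_edge hb.ne'⟩
  rw [disjoint_left] at hdisj ⊢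
  intro x y hx hy
  have hmap {H : SimpleGraph ({v}ᶜ : Set V)} (h : H.spanningCoe.Adj x y) :
      ∃ (hx : x ≠ v) (hy : y ≠ v), H.Adj ⟨x, hx⟩ ⟨y, hy⟩ := by
    obtain ⟨x, y, hxy, rfl, rfl⟩ := (map_adj _ _ _ _).1 h
    exact ⟨x.2, y.2, hxy⟩
  simp only [sup_adj, edge_adj] at hx hy
  grind

lemma hasDisjointConnectedPair_of_ncard_edgeSet_compl {n : ℕ} (hn : 5 ≤ n) :
    ∀ {V : Type*} [Finite V] {G : SimpleGraph V}, Nat.card V = n →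
      Gᶜ.edgeSet.ncard + 3 ≤ n → G.HasDisjointConnectedPair := by
  induction n, hn using Nat.le_induction with
  | base => exact fun hV hG ↦ hasDisjointConnectedPair_of_card_eq_five hV (by omega)
  | succ n hn ih =>
    intro V _ G hV hG
    have hcompl (v : V) : (G.induce {v}ᶜ)ᶜ = Gᶜ.induce {v}ᶜ := by
      ext x y
      simp [Subtype.ext_iff]
    obtain ⟨v, hv⟩ : ∃ v, (Gᶜ.induce {v}ᶜ).edgeSet.ncard + 3 ≤ n := by
      by_cases hbot : Gᶜ = ⊥
      · have : Nonempty V := (Nat.card_pos_iff.1 (by omega)).1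
        refine ⟨Classical.arbitrary V, ?_⟩
        rw [hbot]
        simp
        omega
      · obtain ⟨v, w, hvw⟩ := ne_bot_iff_exists_adj.1 hbot
        refine ⟨v, ?_⟩
        have h₁ := Gᶜ.ncard_edgeSet_induce_compl_singleton v
        have h₂ : 0 < (Gᶜ.neighborSet v).ncard := (Set.ncard_pos).2 ⟨w, hvw⟩
        omega
    have h₁ := Gᶜ.ncard_edgeSet_induce_compl_singleton v
    have h₂ := G.ncard_neighborSet_add_ncard_neighborSet_compl v
    have h₃ := Set.ncard_add_ncard_compl ({v} : Set V)
    rw [Set.ncard_singleton] at h₃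
    refine HasDisjointConnectedPair.of_induce_compl_singleton (v := v)
      (ih (by rw [Nat.card_coe_set_eq]; omega) (by rwa [hcompl])) ?_
    exact Set.one_lt_ncard_iff_nontrivial.1 (by omega)

/-- The complete graph on the vertices other than `v`, with `v` attached as a pendant vertex
at `w`. -/
def pendantComplete (v w : V) : SimpleGraph V :=
  (completeGraph ({v}ᶜ : Set V)).spanningCoe ⊔ edge v w

lemma pendantComplete_adj_left {v w x : V} (hw : w ≠ v) :
    (pendantComplete v w).Adj v x ↔ x = w := by
  simp [pendantComplete, edge_adj]
  grind

lemma induce_pendantComplete (v w : V) : (pendantComplete v w).induce {v}ᶜ = ⊤ := by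
  ext x y
  have hx := x.2
  have hy := y.2
  simp [pendantComplete, edge_adj]
  grind

lemma pendantComplete_connected {v w : V} (hw : w ≠ v) : (pendantComplete v w).Connected :=
  have : Nonempty ({v}ᶜ : Set V) := ⟨⟨w, hw⟩⟩
  connected_top.spanningCoe_sup_edge hw

lemma ncard_edgeSet_top [Finite V] :
    (⊤ : SimpleGraph V).edgeSet.ncard = (Nat.card V).choose 2 := by
  classical
  have := Fintype.ofFinite V
  rw [Set.ncard_eq_toFinset_card', Nat.card_eq_fintype_card,
    ← card_edgeFinset_top_eq_card_choose_two, edgeFinset]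

lemma ncard_edgeSet_add_ncard_edgeSet_compl [Finite V] (G : SimpleGraph V) :
    G.edgeSet.ncard + Gᶜ.edgeSet.ncard = (Nat.card V).choose 2 := by
  rw [← Set.ncard_union_eq (disjoint_edgeSet.2 disjoint_compl_right), ← edgeSet_sup,
    sup_compl_eq_top, ncard_edgeSet_top]

lemma ncard_edgeSet_pendantComplete [Finite V] {v w : V} (hw : w ≠ v) :
    (pendantComplete v w).edgeSet.ncard = (Nat.card V - 1).choose 2 + 1 := by
  have h : (pendantComplete v w).neighborSet v = {w} := by
    ext x
    simp [pendantComplete_adj_left hw]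
  rw [← ncard_edgeSet_induce_compl_singleton _ v, induce_pendantComplete, ncard_edgeSet_top, h,
    Set.ncard_singleton, Nat.card_coe_set_eq, Set.ncard_compl, Set.ncard_singleton]

end SimpleGraph

/-- For `n ≥ 5`, the maximum number of edges of a connected graph on `n`
vertices with `κ̄ₙ = 1` is `C(n-1, 2) + 1`, and it is attained. -/
theorem stmt_16 (n : ℕ) (hn : 5 ≤ n) :
    IsGreatest {m : ℕ | ∃ G : SimpleGraph (Fin n),
        G.Connected ∧ G.kappaBar n = 1 ∧ G.edgeSet.ncard = m}
      ((n - 1).choose 2 + 1) := by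
  have : Nontrivial (Fin n) := Fin.nontrivial_iff_two_le.2 (by omega)
  have hkappa (G : SimpleGraph (Fin n)) : G.kappaBar n = G.steinerConn Set.univ := by
    simpa using G.kappaBar_card
  constructor
  · obtain ⟨v, w, hvw⟩ := exists_pair_ne (Fin n)
    have hconn := pendantComplete_connected hvw.symm
    refine ⟨pendantComplete v w, hconn, ?_, by simp [ncard_edgeSet_pendantComplete hvw.symm]⟩
    rw [hkappa]
    refine le_antisymm
      (steinerConn_univ_le_one_of_pendant fun x ↦ (pendantComplete_adj_left hvw.symm).1) ?_
    exact le_steinerConn_univ (fun _ : Fin 1 ↦ pendantComplete v w) (fun _ ↦ le_rfl)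
      (fun _ ↦ hconn) (fun i j hij ↦ (hij (Subsingleton.elim i j)).elim)
  · rintro m ⟨G, -, hG, rfl⟩
    by_contra! hlt
    have hcompl := G.ncard_edgeSet_add_ncard_edgeSet_compl
    have hchoose : n.choose 2 = (n - 1) + (n - 1).choose 2 := by
      obtain ⟨k, rfl⟩ : ∃ k, n = k + 1 := ⟨n - 1, by omega⟩
      simp [Nat.choose_succ_succ']
    rw [Nat.card_fin] at hcompl
    have h := (hasDisjointConnectedPair_of_ncard_edgeSet_compl hn (G := G) (Nat.card_fin n)
      (by omega)).two_le_steinerConn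
    rw [← hkappa, hG] at h
    omega
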